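/- arXiv:2205.15457 — 2 statements merged into one kernel-verified Lean document; each statement's English description precedes it below -/
import Mathlib

section
/- Let G be a connected, locally compact, second countable topological group with a left Haar measure μ, let Γ ⊆ G be a countable dense subgroup, let I be a countable set equipped with an action of Γ, and let π : G → I be a measurable map such that for every g ∈ Γ, π(gh) = g·π(h) for μ-a.e. h ∈ G. Then π is μ-a.e. equal to a constant. (In particular, the translation action of Γ on G is not induced.) -/
open MeasureTheory
open scoped symmDiff

namespace OESuperrigidity

/-- A map into a (typically countable) discrete space is measurable iff all fibers are
measurable sets. -/
def MeasurableDiscrete {X Λ : Type*} [MeasurableSpace X] (f : X → Λ) : Prop :=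
  ∀ l : Λ, MeasurableSet {x | f x = l}

/-- `a` defines an action of the group `G`. -/
def IsAction {G X : Type*} [Group G] (a : G → X → X) : Prop :=
  (∀ x, a 1 x = x) ∧ ∀ g h x, a (g * h) x = a g (a h x)

/-- `f` defines an action of the additive group `ℝ` (a flow). -/
def IsFlow {Y : Type*} (f : ℝ → Y → Y) : Prop :=
  (∀ y, f 0 y = y) ∧ ∀ s t y, f (s + t) y = f s (f t y)

/-- Each map `a g` is measurable and the pushforward of `μ` under it is equivalent to `μ`. -/
def Nonsingular {ι X : Type*} [MeasurableSpace X] (μ : Measure X) (a : ι → X → X) : Prop :=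
  ∀ g, Measurable (a g) ∧ μ.map (a g) ≪ μ ∧ μ ≪ μ.map (a g)

/-- Every a.e. invariant measurable set is null or conull. -/
def ErgodicAction {ι X : Type*} [MeasurableSpace X] (μ : Measure X) (a : ι → X → X) : Prop :=
  ∀ S : Set X, MeasurableSet S → (∀ g, μ ((a g '' S) ∆ S) = 0) → μ S = 0 ∨ μ Sᶜ = 0

/-- The action is essentially free. -/
def EssentiallyFree {G X : Type*} [Group G] [MeasurableSpace X]
    (μ : Measure X) (a : G → X → X) : Prop :=
  ∀ g : G, g ≠ 1 → μ {x | a g x = x} = 0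

/-- The action is induced from a proper subgroup `G₀` acting on a positive-measure
`G₀`-invariant set `X₀` such that the translates of `X₀` over a set `R` of representatives of
the left cosets of `G₀` are pairwise disjoint up to null sets and cover `X` up to a null set. -/
def IsInduced {G X : Type*} [Group G] [MeasurableSpace X]
    (μ : Measure X) (a : G → X → X) : Prop :=
  ∃ G₀ : Subgroup G, G₀ ≠ ⊤ ∧ ∃ X₀ : Set X, MeasurableSet X₀ ∧ 0 < μ X₀ ∧
    (∀ g ∈ G₀, μ ((a g '' X₀) ∆ X₀) = 0) ∧
    ∃ R : Set G, (∀ g : G, ∃! r, r ∈ R ∧ g⁻¹ * r ∈ G₀) ∧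
      (R.Pairwise fun r s => μ (a r '' X₀ ∩ a s '' X₀) = 0) ∧
      μ (⋃ r ∈ R, a r '' X₀)ᶜ = 0

/-- The subgroup `H` admits a measurable fundamental domain for its action. -/
def HasFundamentalDomain {G X : Type*} [Group G] [MeasurableSpace X]
    (μ : Measure X) (a : G → X → X) (H : Subgroup G) : Prop :=
  ∃ U : Set X, MeasurableSet U ∧
    ((H : Set G).Pairwise fun g h => μ (a g '' U ∩ a h '' U) = 0) ∧
    μ (⋃ g ∈ H, a g '' U)ᶜ = 0

/-- A measurable `1`-cocycle for the action `a` with values in the group `Λ`. -/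
def IsCocycle {G X Λ : Type*} [Group G] [Group Λ] [MeasurableSpace X]
    (μ : Measure X) (a : G → X → X) (Ω : G → X → Λ) : Prop :=
  (∀ g, MeasurableDiscrete (Ω g)) ∧
    ∀ g h : G, ∀ᵐ x ∂μ, Ω (g * h) x = Ω g (a h x) * Ω h x

/-- The cocycle `Ω` is cohomologous to a group homomorphism. -/
def CohomologousToHom {G X Λ : Type*} [Group G] [Group Λ] [MeasurableSpace X]
    (μ : Measure X) (a : G → X → X) (Ω : G → X → Λ) : Prop :=
  ∃ δ : G →* Λ, ∃ φ : X → Λ, MeasurableDiscrete φ ∧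
    ∀ g : G, ∀ᵐ x ∂μ, Ω g x = (φ (a g x))⁻¹ * δ g * φ x

/-- The action is cocycle superrigid with countable targets. -/
def CocycleSuperrigid {G X : Type*} [Group G] [MeasurableSpace X]
    (μ : Measure X) (a : G → X → X) : Prop :=
  ∀ (Λ : Type) [Group Λ] [Countable Λ], ∀ Ω : G → X → Λ,
    IsCocycle μ a Ω → CohomologousToHom μ a Ω

/-- `ω` is (a strict version of) the logarithm of the Radon–Nikodym cocycle of the action. -/
def IsLogRNCocycle {G X : Type*} [Group G] [MeasurableSpace X]
    (μ : Measure X) (a : G → X → X) (ω : G → X → ℝ) : Prop :=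
  (∀ g, Measurable (ω g)) ∧
    (∀ g h : G, ∀ᵐ x ∂μ, ω (g * h) x = ω g (a h x) + ω h x) ∧
    ∀ g : G, (fun x => ENNReal.ofReal (Real.exp (ω g x))) =ᵐ[μ] (μ.map (a g⁻¹)).rnDeriv μ

/-- The `G`-invariant σ-finite measure `dμ(x) e^{-s} ds` on `X × ℝ` used for the
Maharam extension. -/
noncomputable def maharamMeasure {X : Type*} [MeasurableSpace X] (μ : Measure X) :
    Measure (X × ℝ) :=
  μ.prod (volume.withDensity fun s => ENNReal.ofReal (Real.exp (-s)))

/-- The Maharam extension `g · (x, s) = (g · x, ω(g, x) + s)`. -/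
def maharamAct {G X : Type*} (a : G → X → X) (ω : G → X → ℝ) : G → X × ℝ → X × ℝ :=
  fun g p => (a g p.1, ω g p.1 + p.2)

end OESuperrigidity

namespace OESuperrigidity

open MeasureTheory

open scoped Pointwise Topology

/-- Left translation by a countable dense subgroup is ergodic for Haar measure. -/
theorem aeconst_of_countable_dense_subgroup
    {G : Type*} [Group G] [TopologicalSpace G] [IsTopologicalGroup G]
    [LocallyCompactSpace G] [SecondCountableTopology G]
    [MeasurableSpace G] [BorelSpace G]
    (μ : Measure G) [μ.IsHaarMeasure]
    (Γ : Subgroup G) [Countable Γ] (hdense : Dense (Γ : Set G))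
    {A : Set G} (hA : MeasurableSet A) (hinv : ∀ g : Γ, (g : G) • A =ᵐ[μ] A) :
    Filter.EventuallyConst A (ae μ) := by
  set B : Set G := ⋃ g : Γ, (g : G) • A
  have hBA : B =ᵐ[μ] A := by
    have h := Filter.EventuallyEq.countable_iUnion hinv
    rwa [Set.iUnion_const] at h
  have hBm : MeasurableSet B := MeasurableSet.iUnion fun g => hA.const_smul (g : G)
  have hBinv : ∀ g ∈ Γ, ∀ b ∈ B, g * b ∈ B := by
    intro g hg b hb
    obtain ⟨k, hk⟩ := Set.mem_iUnion.1 hb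
    obtain ⟨a, ha, rfl⟩ := Set.mem_smul_set.1 hk
    refine Set.mem_iUnion.2 ⟨⟨g, hg⟩ * k, Set.mem_smul_set.2 ⟨a, ha, ?_⟩⟩
    simp [mul_assoc]
  have hdiff : ∀ x : G, μ ((x • B) \ B) = 0 := by
    intro x
    by_contra hpos
    have hV := Measure.div_mem_nhds_one_of_haar_pos μ ((x • B) \ B)
      ((hBm.const_smul x).diff hBm) (pos_iff_ne_zero.2 hpos)
    have hcont : Filter.Tendsto (fun g : G => g * x⁻¹) (𝓝 x) (𝓝 1) :=
      (continuous_mul_const x⁻¹).tendsto' _ _ (mul_inv_cancel x)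
    obtain ⟨g, hgV, hg⟩ := hdense.inter_nhds_nonempty (hcont hV)
    obtain ⟨c, hc, d, hd, hcd⟩ := Set.mem_div.1 hg
    obtain ⟨b, hb, rfl⟩ := Set.mem_smul_set.1 hd.1
    apply hc.2
    have : c = g * b := by
      rw [div_eq_iff_eq_mul] at hcd
      simpa [mul_assoc] using hcd
    exact this ▸ hBinv g hgV b hb
  refine Filter.EventuallyConst.congr ?_ hBA
  refine aeconst_of_forall_smul_ae_eq G hBm.nullMeasurableSet fun x => ?_
  refine Filter.EventuallyLE.antisymm (ae_le_set.2 (hdiff x)) (ae_le_set.2 ?_)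
  have h := hdiff x⁻¹
  rwa [← measure_smul μ x, Set.smul_set_sdiff, smul_inv_smul] at h

/-- In a connected group, a set of positive Haar measure each of whose translates under a
countable dense subgroup is a.e. equal to it or a.e. disjoint from it is conull. -/
theorem measure_compl_eq_zero_of_translates_ae_eq_or_disjoint
    {G : Type*} [Group G] [TopologicalSpace G] [IsTopologicalGroup G]
    [ConnectedSpace G] [LocallyCompactSpace G] [SecondCountableTopology G]
    [MeasurableSpace G] [BorelSpace G]
    (μ : Measure G) [μ.IsHaarMeasure]
    (Γ : Subgroup G) [Countable Γ] (hdense : Dense (Γ : Set G))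
    {A : Set G} (hA : MeasurableSet A) (hpos : μ A ≠ 0)
    (hdich : ∀ g : Γ, μ ((g : G) • A ∩ A) = 0 ∨ (g : G) • A =ᵐ[μ] A) :
    μ Aᶜ = 0 := by
  set N : Set G := ⋃ g : {g : Γ // μ ((g : G) • A ∩ A) = 0}, ((g : Γ) : G) • A ∩ A
  have hN0 : μ N = 0 := measure_iUnion_null fun g => g.2
  have hNm : MeasurableSet N := MeasurableSet.iUnion fun g => (hA.const_smul _).inter hA
  have hV := Measure.div_mem_nhds_one_of_haar_pos μ (A \ N) (hA.diff hNm)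
    (by rw [measure_sdiff_null hN0]; exact pos_iff_ne_zero.2 hpos)
  set V : Set G := (A \ N) / (A \ N)
  set H : Subgroup G := MulAction.aestabilizer G μ A ⊓ Γ
  have hVH : ∀ g ∈ Γ, g ∈ V → g ∈ H := by
    intro g hg hgV
    refine ⟨?_, hg⟩
    refine (hdich ⟨g, hg⟩).resolve_left fun h0 => ?_
    obtain ⟨a, ha, b, hb, rfl⟩ := Set.mem_div.1 hgV
    refine ha.2 (Set.mem_iUnion.2 ⟨⟨⟨a / b, hg⟩, h0⟩, ?_, ha.1⟩)
    exact Set.mem_smul_set.2 ⟨b, hb.1, by simp⟩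
  have hnhds : (H.topologicalClosure : Set G) ∈ 𝓝 (1 : G) := by
    refine Filter.mem_of_superset (interior_mem_nhds.2 hV) ?_
    refine (hdense.open_subset_closure_inter isOpen_interior).trans (closure_mono ?_)
    exact fun g hg => hVH g hg.2 (interior_subset hg.1)
  have huniv : (H.topologicalClosure : Set G) = Set.univ :=
    IsClopen.eq_univ ⟨H.isClosed_topologicalClosure, Subgroup.isOpen_of_mem_nhds _ hnhds⟩
      ⟨1, one_mem _⟩
  have hHdense : Dense (H : Set G) := dense_iff_closure_eq.2 huniv
  have hΓH : ∀ g ∈ Γ, g ∈ H := by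
    intro g hg
    have hcont : Filter.Tendsto (fun h : G => h⁻¹ * g) (𝓝 g) (𝓝 1) :=
      (continuous_inv.mul continuous_const).tendsto' _ _ (inv_mul_cancel g)
    obtain ⟨h, hh, hhV⟩ := hHdense.inter_nhds_nonempty (hcont hV)
    have := H.mul_mem hh (hVH _ (Γ.mul_mem (Γ.inv_mem hh.2) hg) hhV)
    rwa [mul_inv_cancel_left] at this
  rcases Filter.eventuallyConst_set'.1
    (aeconst_of_countable_dense_subgroup μ Γ hdense hA fun g => (hΓH g g.2).1) with h | h
  · exact absurd (ae_eq_empty.1 h) hpos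
  · exact ae_eq_univ.1 h

/-- If `G` is a connected locally compact second countable group with left
Haar measure `μ` and `Γ ⊆ G` is a countable dense subgroup, then every measurable map from
`G` to a countable `Γ`-set `I` that is equivariant for the left translation action of `Γ` is
a.e. constant; in particular the translation action `Γ ↷ G` is not induced. -/
theorem equivariant_map_of_dense_subgroup_constant
    {G : Type} [Group G] [TopologicalSpace G] [IsTopologicalGroup G]
    [ConnectedSpace G] [LocallyCompactSpace G] [SecondCountableTopology G]
    [MeasurableSpace G] [BorelSpace G]
    (μ : Measure G) [μ.IsHaarMeasure]
    (Γ : Subgroup G) (hcount : Countable Γ) (hdense : Dense (Γ : Set G)) :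
    (∀ (I : Type) [Countable I], ∀ σ : Γ → I → I, IsAction σ →
      ∀ π : G → I, MeasurableDiscrete π →
        (∀ g : Γ, ∀ᵐ h ∂μ, π ((g : G) * h) = σ g (π h)) →
        ∃ c : I, ∀ᵐ h ∂μ, π h = c) ∧
    ¬ IsInduced μ (fun (g : Γ) (h : G) => (g : G) * h) := by
  constructor
  · intro I _ σ hσ π hπ heq
    obtain ⟨i, hi⟩ : ∃ i, μ {x | π x = i} ≠ 0 := by
      by_contra! h
      have h0 : μ (⋃ i, {x | π x = i}) = 0 := measure_iUnion_null h
      rw [show (⋃ i, {x | π x = i}) = Set.univ by ext; simp] at h0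
      exact NeZero.ne μ (Measure.measure_univ_eq_zero.1 h0)
    refine ⟨i, measure_compl_eq_zero_of_translates_ae_eq_or_disjoint μ Γ hdense (hπ i) hi
      fun g => ?_⟩
    have hmem : ∀ᵐ h ∂μ, h ∈ (g : G) • {x | π x = i} ↔ π h = σ g i := by
      filter_upwards [heq g⁻¹] with h hh
      rw [Set.mem_smul_set_iff_inv_smul_mem]
      have hh' : π ((g : G)⁻¹ * h) = σ g⁻¹ (π h) := by simpa using hh
      change π ((g : G)⁻¹ * h) = i ↔ _
      rw [hh']
      constructor
      · rintro rfl
        rw [← hσ.2, mul_inv_cancel, hσ.1]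
      · intro h1
        rw [h1, ← hσ.2, inv_mul_cancel, hσ.1]
    by_cases hgi : σ g i = i
    · right
      filter_upwards [hmem] with h hh
      rw [hgi] at hh
      exact propext hh
    · left
      rw [measure_eq_zero_iff_ae_notMem]
      filter_upwards [hmem] with h hh hmem'
      exact hgi ((hh.1 hmem'.1).symm.trans hmem'.2)
  · rintro ⟨G₀, hG₀, X, hX, hXpos, hinv, R, hR, hdisj, -⟩
    change ∀ g ∈ G₀, μ (((g : G) • X) ∆ X) = 0 at hinv
    change R.Pairwise fun r s => μ ((r : G) • X ∩ (s : G) • X) = 0 at hdisj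
    have hrep : ∀ g r : Γ, g⁻¹ * r ∈ G₀ → (r : G) • X =ᵐ[μ] (g : G) • X := by
      intro g r hgr
      have h := hinv _ hgr
      rw [← measure_smul μ (g : G), Set.smul_set_symmDiff, smul_smul] at h
      simpa using measure_symmDiff_eq_zero_iff.1 h
    obtain ⟨s, ⟨hsR, hs⟩, -⟩ := hR 1
    have hsX : (s : G) • X =ᵐ[μ] X := by simpa using hrep 1 s hs
    have hnull : ∀ g r : Γ, r ∈ R → g⁻¹ * r ∈ G₀ → r ≠ s → μ ((g : G) • X ∩ X) = 0 := by
      intro g r hrR hr hrs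
      rw [← hdisj hrR hsR hrs]
      exact measure_congr ((hrep g r hr).symm.inter hsX.symm)
    have hconull : μ Xᶜ = 0 := by
      refine measure_compl_eq_zero_of_translates_ae_eq_or_disjoint μ Γ hdense hX hXpos.ne'
        fun g => ?_
      obtain ⟨r, ⟨hrR, hr⟩, -⟩ := hR g
      by_cases hrs : r = s
      · subst hrs
        exact Or.inr ((hrep g r hr).symm.trans hsX)
      · exact Or.inl (hnull g r hrR hr hrs)
    obtain ⟨g, hg⟩ : ∃ g, g ∉ G₀ := by
      by_contra! h
      exact hG₀ ((Subgroup.eq_top_iff' _).2 h)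
    obtain ⟨r, ⟨hrR, hr⟩, -⟩ := hR g
    have hrs : r ≠ s := by
      rintro rfl
      apply hg
      have := G₀.mul_mem hs (G₀.inv_mem hr)
      simpa using this
    have hgX := hnull g r hrR hr hrs
    rw [measure_inter_conull hconull, measure_smul] at hgX
    exact hXpos.ne' hgX

end OESuperrigidity
end

section
/- Let n ≥ 1 be an integer and let ξ, η : ℝⁿ → ℂ be measurable functions that are square-integrable with respect to Lebesgue measure. Then for every ε > 0 there is a compact subset K ⊆ GL(n,ℝ) × ℝⁿ such that for all (A,a) ∈ (GL(n,ℝ) × ℝⁿ) ∖ K, one has |∫_{ℝⁿ} |det A|^{−1/2} · ξ(A⁻¹x − a) · conj(η(x)) dx| < ε. In other words, all matrix coefficients of the unitary representation π of GL(n,ℝ) ⋉ ℝⁿ on L²(ℝⁿ) defined by (π(A,a)ξ)(x) = |det A|^{−1/2} ξ(A⁻¹x − a) vanish at infinity, i.e. π is a C₀-representation. -/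
open MeasureTheory

theorem Matrix.GeneralLinearGroup.exists_unitary_diagonal_unitary {ι : Type*} [Fintype ι]
    [DecidableEq ι] (A : Matrix.GeneralLinearGroup ι ℝ) :
    ∃ W ∈ Matrix.unitaryGroup ι ℝ, ∃ V ∈ Matrix.unitaryGroup ι ℝ, ∃ s : ι → ℝ,
      (∀ i, 0 < s i) ∧ (A : Matrix ι ι ℝ) = W * Matrix.diagonal s * V := by
  set M : Matrix ι ι ℝ := A.val
  have hpos : (star M * M).PosDef := by
    rw [Matrix.star_eq_conjTranspose]
    exact Matrix.PosDef.conjTranspose_mul_self _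
      (Matrix.mulVec_injective_of_isUnit (Units.isUnit A))
  set U : Matrix ι ι ℝ := hpos.1.eigenvectorUnitary.val with hU
  have hUmem : U ∈ Matrix.unitaryGroup ι ℝ := hpos.1.eigenvectorUnitary.2
  have hUU : star U * U = 1 := Matrix.mem_unitaryGroup_iff'.1 hUmem
  have hUU' : U * star U = 1 := Matrix.mem_unitaryGroup_iff.1 hUmem
  have hspec : star M * M = U * Matrix.diagonal hpos.1.eigenvalues * star U := by
    conv_lhs => rw [hpos.1.spectral_theorem]
    simp [Unitary.conjStarAlgAut_apply, hU]
  set s : ι → ℝ := fun i => √(hpos.1.eigenvalues i)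
  have hspos : ∀ i, 0 < s i := fun i => Real.sqrt_pos.2 (hpos.eigenvalues_pos i)
  have hinv : Matrix.diagonal s⁻¹ * Matrix.diagonal s = 1 := by
    rw [Matrix.diagonal_mul_diagonal, ← Matrix.diagonal_one]
    congr 1; funext i; simp [(hspos i).ne']
  refine ⟨M * U * Matrix.diagonal s⁻¹, ?_, star U, Unitary.star_mem hUmem, s, hspos, ?_⟩
  · rw [Matrix.mem_unitaryGroup_iff']
    have hd : star (Matrix.diagonal s⁻¹) = Matrix.diagonal s⁻¹ := by
      simp [Matrix.star_eq_conjTranspose]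
    have : star (M * U * Matrix.diagonal s⁻¹) * (M * U * Matrix.diagonal s⁻¹) =
        Matrix.diagonal s⁻¹ * (star U * (star M * M) * U) * Matrix.diagonal s⁻¹ := by
      rw [star_mul, star_mul, hd]; noncomm_ring
    rw [this, hspec]
    have : star U * (U * Matrix.diagonal hpos.1.eigenvalues * star U) * U =
        (star U * U) * Matrix.diagonal hpos.1.eigenvalues * (star U * U) := by noncomm_ring
    rw [this, hUU, one_mul, mul_one, Matrix.diagonal_mul_diagonal, Matrix.diagonal_mul_diagonal,
      ← Matrix.diagonal_one]
    congr 1; funext i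
    have h := Real.mul_self_sqrt (hpos.eigenvalues_pos i).le
    have h' := hspos i
    simp only [Pi.inv_apply]
    rw [← h]
    change (s i)⁻¹ * (s i * s i) * (s i)⁻¹ = 1
    field_simp
  · rw [mul_assoc (M * U), hinv, mul_one, mul_assoc, hUU', mul_one]

theorem Matrix.norm_mulVec_le_of_forall_abs_le {n : ℕ} {M : Matrix (Fin n) (Fin n) ℝ} {c : ℝ}
    (hc : 0 ≤ c) (hM : ∀ i j, |M i j| ≤ c) (x : Fin n → ℝ) : ‖M.mulVec x‖ ≤ n * c * ‖x‖ := by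
  refine (pi_norm_le_iff_of_nonneg (by positivity)).2 fun i => ?_
  calc ‖M.mulVec x i‖ ≤ ∑ j, ‖M i j * x j‖ := norm_sum_le Finset.univ fun j => M i j * x j
    _ ≤ ∑ _j : Fin n, c * ‖x‖ := by
        refine Finset.sum_le_sum fun j _ => ?_
        rw [norm_mul]
        exact mul_le_mul (hM i j) (norm_le_pi_norm x j) (norm_nonneg _) hc
    _ = n * c * ‖x‖ := by simp [mul_assoc]

theorem Matrix.norm_mulVec_le_of_mem_unitaryGroup {n : ℕ} {W : Matrix (Fin n) (Fin n) ℝ}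
    (hW : W ∈ Matrix.unitaryGroup (Fin n) ℝ) (x : Fin n → ℝ) : ‖W.mulVec x‖ ≤ n * ‖x‖ := by
  simpa using Matrix.norm_mulVec_le_of_forall_abs_le zero_le_one
    (fun i j => entry_norm_bound_of_unitary hW i j) x

theorem Matrix.abs_mul_diagonal_mul_apply_le {n : ℕ} {W V : Matrix (Fin n) (Fin n) ℝ}
    (hW : W ∈ Matrix.unitaryGroup (Fin n) ℝ) (hV : V ∈ Matrix.unitaryGroup (Fin n) ℝ)
    {s : Fin n → ℝ} {c : ℝ} (hs : ∀ i, |s i| ≤ c) (i j : Fin n) :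
    |(W * Matrix.diagonal s * V) i j| ≤ n * c := by
  rw [Matrix.mul_apply]
  calc |∑ k, (W * Matrix.diagonal s) i k * V k j|
      ≤ ∑ k, |(W * Matrix.diagonal s) i k * V k j| := Finset.abs_sum_le_sum_abs _ _
    _ ≤ ∑ _k : Fin n, c := by
        refine Finset.sum_le_sum fun k _ => ?_
        have h1 : |W i k| ≤ 1 := entry_norm_bound_of_unitary hW i k
        have h2 : |V k j| ≤ 1 := entry_norm_bound_of_unitary hV k j
        rw [Matrix.mul_diagonal, abs_mul, abs_mul]
        calc |W i k| * |s k| * |V k j| ≤ 1 * |s k| * 1 := by gcongr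
          _ ≤ c := by simpa using hs k
    _ = n * c := by simp

theorem Matrix.GeneralLinearGroup.coe_inv_eq_of_eq_mul_diagonal_mul {n : ℕ}
    {A : Matrix.GeneralLinearGroup (Fin n) ℝ} {W V : Matrix (Fin n) (Fin n) ℝ}
    (hW : W ∈ Matrix.unitaryGroup (Fin n) ℝ) (hV : V ∈ Matrix.unitaryGroup (Fin n) ℝ)
    {s : Fin n → ℝ} (hs : ∀ i, 0 < s i)
    (hA : (A : Matrix (Fin n) (Fin n) ℝ) = W * Matrix.diagonal s * V) :
    ((A⁻¹ : Matrix.GeneralLinearGroup (Fin n) ℝ) : Matrix (Fin n) (Fin n) ℝ) =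
      star V * Matrix.diagonal s⁻¹ * star W := by
  rw [Matrix.coe_units_inv]
  refine Matrix.inv_eq_left_inv ?_
  have hinv : Matrix.diagonal s⁻¹ * Matrix.diagonal s = 1 := by
    rw [Matrix.diagonal_mul_diagonal, ← Matrix.diagonal_one]
    congr 1; funext i; simp [(hs i).ne']
  have : star V * Matrix.diagonal s⁻¹ * star W * (W * Matrix.diagonal s * V) =
      star V * (Matrix.diagonal s⁻¹ * (star W * W) * Matrix.diagonal s) * V := by noncomm_ring
  rw [hA, this, Matrix.mem_unitaryGroup_iff'.1 hW, mul_one, hinv, mul_one,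
    Matrix.mem_unitaryGroup_iff'.1 hV]

theorem Matrix.abs_det_eq_one_of_mem_unitaryGroup {n : ℕ} {W : Matrix (Fin n) (Fin n) ℝ}
    (hW : W ∈ Matrix.unitaryGroup (Fin n) ℝ) : |W.det| = 1 := by
  have := Matrix.det_of_mem_unitary hW
  simpa using CStarRing.norm_of_mem_unitary this

theorem Matrix.volume_preimage_mulVec_unitary {n : ℕ} {W : Matrix (Fin n) (Fin n) ℝ}
    (hW : W ∈ Matrix.unitaryGroup (Fin n) ℝ) (S : Set (Fin n → ℝ)) :
    volume ((fun x => W.mulVec x) ⁻¹' S) = volume S := by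
  have h1 := Matrix.abs_det_eq_one_of_mem_unitaryGroup hW
  have h := Measure.addHaar_preimage_linearMap (volume : Measure (Fin n → ℝ))
    (f := Matrix.toLin' W) (by rw [LinearMap.det_toLin']; intro h; simp [h] at h1) S
  rw [LinearMap.det_toLin', abs_inv, h1] at h
  simpa [Matrix.toLin'_apply, Set.preimage] using h

/-- The part of the ball of radius `R` that an affine map sends into the ball of radius `R`. -/
def affineOverlap {n : ℕ} (A : Matrix.GeneralLinearGroup (Fin n) ℝ) (a : Fin n → ℝ) (R : ℝ) :
    Set (Fin n → ℝ) :=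
  {x | ‖x‖ ≤ R ∧ ‖((A⁻¹ : Matrix.GeneralLinearGroup (Fin n) ℝ) :
    Matrix (Fin n) (Fin n) ℝ).mulVec x - a‖ ≤ R}

theorem volume_affineOverlap_le {n : ℕ} {A : Matrix.GeneralLinearGroup (Fin n) ℝ}
    {W V : Matrix (Fin n) (Fin n) ℝ}
    (hW : W ∈ Matrix.unitaryGroup (Fin n) ℝ) (hV : V ∈ Matrix.unitaryGroup (Fin n) ℝ)
    {s : Fin n → ℝ} (hs : ∀ i, 0 < s i)
    (hA : (A : Matrix (Fin n) (Fin n) ℝ) = W * Matrix.diagonal s * V) (a : Fin n → ℝ) {R : ℝ}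
    (hR : 0 ≤ R) :
    volume (affineOverlap A a R) ≤ ENNReal.ofReal (∏ i, 2 * (n * R) * min 1 (s i)) := by
  set T : ℝ := n * R
  have hT : 0 ≤ T := by positivity
  set b := V.mulVec a
  have hsub : (fun x => W.mulVec x) ⁻¹' affineOverlap A a R ⊆
      Set.univ.pi fun i =>
        Set.Icc (-T) T ∩ Set.Icc (s i * (b i - T)) (s i * (b i + T)) := by
    intro z hz i _
    obtain ⟨h1, h2⟩ := hz
    have hz' : ‖z‖ ≤ T := by
      have := Matrix.norm_mulVec_le_of_mem_unitaryGroup (Unitary.star_mem hW) (W.mulVec z)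
      rw [Matrix.mulVec_mulVec, Matrix.mem_unitaryGroup_iff'.1 hW, Matrix.one_mulVec] at this
      exact this.trans (mul_le_mul_of_nonneg_left h1 (by positivity))
    have hy : ‖(Matrix.diagonal s⁻¹).mulVec z - b‖ ≤ T := by
      have := Matrix.norm_mulVec_le_of_mem_unitaryGroup hV
        (((A⁻¹ : Matrix.GeneralLinearGroup (Fin n) ℝ) :
          Matrix (Fin n) (Fin n) ℝ).mulVec (W.mulVec z) - a)
      rw [Matrix.mulVec_sub, Matrix.GeneralLinearGroup.coe_inv_eq_of_eq_mul_diagonal_mul hW hV hs hA,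
        Matrix.mulVec_mulVec, Matrix.mulVec_mulVec] at this
      have e : V * (star V * Matrix.diagonal s⁻¹ * star W) * W =
        (V * star V) * Matrix.diagonal s⁻¹ * (star W * W) := by noncomm_ring
      rw [e, Matrix.mem_unitaryGroup_iff'.1 hW, Matrix.mem_unitaryGroup_iff.1 hV, one_mul,
        mul_one, ← Matrix.GeneralLinearGroup.coe_inv_eq_of_eq_mul_diagonal_mul hW hV hs hA] at this
      exact this.trans (mul_le_mul_of_nonneg_left h2 (by positivity))
    have h3 := (norm_le_pi_norm _ i).trans hz'
    have h4 := (norm_le_pi_norm _ i).trans hy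
    rw [Pi.sub_apply, Matrix.mulVec_diagonal, Real.norm_eq_abs, abs_le] at h4
    rw [Real.norm_eq_abs, abs_le] at h3
    have hzi : z i = s i * (s⁻¹ i * z i) := by
      rw [Pi.inv_apply, mul_inv_cancel_left₀ (hs i).ne']
    refine ⟨h3, ?_, ?_⟩ <;> rw [hzi] <;> apply mul_le_mul_of_nonneg_left _ (hs i).le <;> linarith
  rw [← Matrix.volume_preimage_mulVec_unitary hW]
  refine (measure_mono hsub).trans ?_
  rw [volume_pi_pi, ENNReal.ofReal_prod_of_nonneg
    fun i _ => mul_nonneg (by positivity) (le_min zero_le_one (hs i).le)]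
  refine Finset.prod_le_prod' fun i _ => ?_
  rw [mul_min_of_nonneg _ _ (by positivity), ENNReal.ofReal_min]
  refine le_min ?_ ?_
  · refine (measure_mono Set.inter_subset_left).trans ?_
    rw [Real.volume_Icc]
    exact ENNReal.ofReal_le_ofReal (by linarith)
  · refine (measure_mono Set.inter_subset_right).trans ?_
    rw [Real.volume_Icc]
    exact ENNReal.ofReal_le_ofReal (by linarith)

/-- The operator `π(A, a)` on functions: `(π(A, a) ξ)(x) = |det A|^{-1/2} ξ(A⁻¹ x - a)`. -/
noncomputable def affineAct {n : ℕ} (A : Matrix.GeneralLinearGroup (Fin n) ℝ) (a : Fin n → ℝ)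
    (ξ : (Fin n → ℝ) → ℂ) (x : Fin n → ℝ) : ℂ :=
  ((|((A : Matrix (Fin n) (Fin n) ℝ).det)| ^ (-(1 / 2 : ℝ)) : ℝ) : ℂ) *
    ξ (((A⁻¹ : Matrix.GeneralLinearGroup (Fin n) ℝ) : Matrix (Fin n) (Fin n) ℝ).mulVec x - a)

theorem map_affine_volume {n : ℕ} (A : Matrix.GeneralLinearGroup (Fin n) ℝ) (a : Fin n → ℝ) :
    Measure.map (fun x => ((A⁻¹ : Matrix.GeneralLinearGroup (Fin n) ℝ) :
      Matrix (Fin n) (Fin n) ℝ).mulVec x - a) (volume : Measure (Fin n → ℝ)) =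
      ENNReal.ofReal |(A : Matrix (Fin n) (Fin n) ℝ).det| • volume := by
  have hdet : ((A⁻¹ : Matrix.GeneralLinearGroup (Fin n) ℝ) : Matrix (Fin n) (Fin n) ℝ).det ≠ 0 :=
    ((Matrix.isUnit_iff_isUnit_det _).1 (Units.isUnit A⁻¹)).ne_zero
  have hmeas : Measurable (Matrix.toLin' ((A⁻¹ : Matrix.GeneralLinearGroup (Fin n) ℝ) :
      Matrix (Fin n) (Fin n) ℝ)) :=
    (LinearMap.continuous_of_finiteDimensional _).measurable
  have h := Real.map_matrix_volume_pi_eq_smul_volume_pi hdet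
  have hcomp : (fun x => ((A⁻¹ : Matrix.GeneralLinearGroup (Fin n) ℝ) :
      Matrix (Fin n) (Fin n) ℝ).mulVec x - a) = (fun y => y - a) ∘
      Matrix.toLin' ((A⁻¹ : Matrix.GeneralLinearGroup (Fin n) ℝ) : Matrix (Fin n) (Fin n) ℝ) := by
    funext x; simp
  rw [hcomp, ← Measure.map_map (measurable_sub_const a) hmeas, h, Measure.map_smul,
    (measurePreserving_sub_right volume a).map_eq, Matrix.coe_units_inv, Matrix.det_nonsing_inv,
    Ring.inverse_eq_inv', inv_inv]

theorem memLp_affineAct {n : ℕ} (A : Matrix.GeneralLinearGroup (Fin n) ℝ) (a : Fin n → ℝ)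
    {ξ : (Fin n → ℝ) → ℂ} (hξ : MemLp ξ 2 volume) : MemLp (affineAct A a ξ) 2 volume := by
  have hm : Measurable fun x => ((A⁻¹ : Matrix.GeneralLinearGroup (Fin n) ℝ) :
      Matrix (Fin n) (Fin n) ℝ).mulVec x - a := by
    refine Continuous.measurable ?_
    fun_prop
  refine MemLp.const_mul (MemLp.comp_of_map ?_ hm.aemeasurable) _
  rw [map_affine_volume]
  exact hξ.smul_measure ENNReal.ofReal_ne_top

theorem eLpNorm_affineAct {n : ℕ} (A : Matrix.GeneralLinearGroup (Fin n) ℝ) (a : Fin n → ℝ)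
    {ξ : (Fin n → ℝ) → ℂ} (hξ : MemLp ξ 2 volume) :
    eLpNorm (affineAct A a ξ) 2 volume = eLpNorm ξ 2 volume := by
  have hm : Measurable fun x => ((A⁻¹ : Matrix.GeneralLinearGroup (Fin n) ℝ) :
      Matrix (Fin n) (Fin n) ℝ).mulVec x - a := by
    refine Continuous.measurable ?_
    fun_prop
  have hd : 0 < |(A : Matrix (Fin n) (Fin n) ℝ).det| :=
    abs_pos.2 ((Matrix.isUnit_iff_isUnit_det _).1 (Units.isUnit A)).ne_zero
  have hξ' : AEStronglyMeasurable ξ (Measure.map (fun x =>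
      ((A⁻¹ : Matrix.GeneralLinearGroup (Fin n) ℝ) :
      Matrix (Fin n) (Fin n) ℝ).mulVec x - a) volume) := by
    rw [map_affine_volume]
    exact hξ.1.smul_measure _
  have h := eLpNorm_map_measure (p := 2) hξ' hm.aemeasurable
  rw [map_affine_volume, eLpNorm_smul_measure_of_ne_top (by norm_num)] at h
  change eLpNorm ((((|((A : Matrix (Fin n) (Fin n) ℝ).det)| ^ (-(1 / 2 : ℝ)) : ℝ) : ℂ)) •
    (ξ ∘ _)) 2 volume = _
  rw [eLpNorm_const_smul, ← h, smul_eq_mul, ← mul_assoc]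
  have hc : ‖(((|((A : Matrix (Fin n) (Fin n) ℝ).det)| ^ (-(1 / 2 : ℝ)) : ℝ) : ℂ))‖ₑ *
      ENNReal.ofReal |(A : Matrix (Fin n) (Fin n) ℝ).det| ^ (1 / (2 : ENNReal)).toReal = 1 := by
    rw [← ofReal_norm, Complex.norm_real, Real.norm_of_nonneg (by positivity),
      ENNReal.ofReal_rpow_of_pos hd, ← ENNReal.ofReal_mul (by positivity), ← Real.rpow_add hd]
    norm_num
  rw [hc, one_mul]

theorem norm_integral_mul_conj_le {α : Type*} [MeasurableSpace α] {μ : Measure α} {f g : α → ℂ}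
    (hf : MemLp f 2 μ) (hg : MemLp g 2 μ) :
    ‖∫ x, f x * (starRingEnd ℂ) (g x) ∂μ‖ ≤ (eLpNorm f 2 μ).toReal * (eLpNorm g 2 μ).toReal := by
  have h := eLpNorm_le_eLpNorm_mul_eLpNorm'_of_norm (p := 2) (q := 2) (r := 1) hf.1 hg.1
    (fun u v : ℂ => u * (starRingEnd ℂ) v) 1 (.of_forall fun x => by simp)
  rw [ENNReal.coe_one, one_mul, eLpNorm_one_eq_lintegral_enorm] at h
  rw [← ENNReal.toReal_mul, ← toReal_enorm]
  exact ENNReal.toReal_mono (ENNReal.mul_ne_top hf.2.ne hg.2.ne)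
    ((enorm_integral_le_lintegral_enorm _).trans h)

theorem integrable_mul_conj {α : Type*} [MeasurableSpace α] {μ : Measure α} {f g : α → ℂ}
    (hf : MemLp f 2 μ) (hg : MemLp g 2 μ) :
    Integrable (fun x => f x * (starRingEnd ℂ) (g x)) μ :=
  hf.integrable_mul hg.star

theorem exists_bounded_boundedSupport_eLpNorm_sub_le {n : ℕ} {ξ : (Fin n → ℝ) → ℂ}
    (hξ : MemLp ξ 2 volume) {ε : ℝ} (hε : 0 < ε) :
    ∃ ξ' : (Fin n → ℝ) → ℂ, MemLp ξ' 2 volume ∧ (eLpNorm (ξ - ξ') 2 volume).toReal ≤ ε ∧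
      ∃ R, 0 ≤ R ∧ ∀ x, ‖ξ' x‖ ≤ R ∧ (R < ‖x‖ → ξ' x = 0) := by
  obtain ⟨g, hg, hle, hcont, hmem⟩ := hξ.exists_hasCompactSupport_eLpNorm_sub_le
    (by norm_num) (ε := ENNReal.ofReal ε) (by simpa using hε)
  obtain ⟨M, hM⟩ := hcont.bounded_above_of_compact_support hg
  obtain ⟨r, hr⟩ := hg.isCompact.isBounded.subset_closedBall 0
  refine ⟨g, hmem, ENNReal.toReal_le_of_le_ofReal hε.le hle, max 0 (max M r), le_max_left _ _,
    fun x => ⟨(hM x).trans ((le_max_left _ _).trans (le_max_right _ _)), fun hx => ?_⟩⟩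
  refine image_eq_zero_of_notMem_tsupport fun hmem => ?_
  have := hr hmem
  rw [mem_closedBall_zero_iff] at this
  exact absurd (this.trans ((le_max_right _ _).trans (le_max_right _ _))) (not_le.2 hx)

theorem norm_integral_affineAct_le {n : ℕ} (A : Matrix.GeneralLinearGroup (Fin n) ℝ)
    (a : Fin n → ℝ) {ξ η : (Fin n → ℝ) → ℂ} {M R : ℝ}
    (hξ : ∀ x, ‖ξ x‖ ≤ M ∧ (R < ‖x‖ → ξ x = 0)) (hη : ∀ x, ‖η x‖ ≤ M ∧ (R < ‖x‖ → η x = 0)) :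
    ‖∫ x, affineAct A a ξ x * (starRingEnd ℂ) (η x)‖ ≤
      |((A : Matrix (Fin n) (Fin n) ℝ).det)| ^ (-(1 / 2 : ℝ)) * M ^ 2 *
        (volume (affineOverlap A a R)).toReal := by
  rw [← setIntegral_eq_integral_of_forall_compl_eq_zero (s := affineOverlap A a R)]
  · refine norm_setIntegral_le_of_norm_le_const ?_ fun x _ => ?_
    · refine (measure_mono (t := Metric.closedBall 0 R) fun x hx => ?_).trans_lt
        measure_closedBall_lt_top
      exact mem_closedBall_zero_iff.2 hx.1
    · rw [affineAct, norm_mul, norm_mul, Complex.norm_real, Real.norm_of_nonneg (by positivity),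
        RCLike.norm_conj, mul_assoc, pow_two]
      have := (norm_nonneg _).trans (hξ 0).1
      gcongr
      · exact (hξ _).1
      · exact (hη _).1
  · intro x hx
    rw [affineOverlap, Set.mem_ofPred_eq, not_and_or, not_le, not_le] at hx
    rcases hx with hx | hx
    · simp [(hη x).2 hx]
    · rw [affineAct, (hξ _).2 hx, mul_zero, zero_mul]

theorem isCompact_setOf_abs_entries_le (n : ℕ) (c : ℝ) :
    IsCompact {A : Matrix.GeneralLinearGroup (Fin n) ℝ |
      (∀ i j, |(A : Matrix (Fin n) (Fin n) ℝ) i j| ≤ c) ∧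
      ∀ i j, |((A⁻¹ : Matrix.GeneralLinearGroup (Fin n) ℝ) :
        Matrix (Fin n) (Fin n) ℝ) i j| ≤ c} := by
  have hK : IsCompact {M : Matrix (Fin n) (Fin n) ℝ | ∀ i j, |M i j| ≤ c} := by
    have h : IsCompact (Set.univ.pi fun _ : Fin n => Set.univ.pi fun _ : Fin n => Set.Icc (-c) c) :=
      isCompact_univ_pi fun _ => isCompact_univ_pi fun _ => isCompact_Icc
    refine Eq.subst (motive := IsCompact) (Set.ext fun M => ?_) h
    simp only [Set.mem_ofPred_eq, abs_le]
    exact ⟨fun h i j => h i trivial j trivial, fun h i _ j _ => h i j⟩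
  have h := Units.isClosedEmbedding_embedProduct.isCompact_preimage
    (hK.prod (hK.image MulOpposite.continuous_op))
  refine Eq.subst (motive := IsCompact) (Set.ext fun A => and_congr Iff.rfl ?_) h
  exact MulOpposite.op_injective.mem_set_image

theorem rpow_neg_half_mul_min_le_one {t : ℝ} (ht : 0 < t) :
    t ^ (-(1 / 2 : ℝ)) * min 1 t ≤ 1 := by
  rw [Real.rpow_neg ht.le, ← Real.sqrt_eq_rpow, inv_mul_le_iff₀ (Real.sqrt_pos.2 ht), mul_one]
  rcases le_total t 1 with h | h
  · rw [min_eq_right h]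
    exact Real.le_sqrt_of_sq_le (by nlinarith)
  · rw [min_eq_left h]
    exact Real.one_le_sqrt.2 h

theorem rpow_neg_half_mul_min_le {t δ : ℝ} (ht : 0 < t) (hδ : 0 < δ)
    (h : t ≤ δ ^ 2 ∨ (δ ^ 2)⁻¹ ≤ t) : t ^ (-(1 / 2 : ℝ)) * min 1 t ≤ δ := by
  rw [Real.rpow_neg ht.le, ← Real.sqrt_eq_rpow, inv_mul_le_iff₀ (Real.sqrt_pos.2 ht)]
  rcases h with h | h
  · refine (min_le_right _ _).trans ?_
    have : √t ≤ δ := Real.sqrt_le_iff.2 ⟨hδ.le, h⟩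
    calc t = √t * √t := (Real.mul_self_sqrt ht.le).symm
      _ ≤ √t * δ := by gcongr
  · refine (min_le_left _ _).trans ?_
    have : δ⁻¹ ≤ √t := Real.le_sqrt_of_sq_le (by rwa [inv_pow])
    rwa [inv_le_iff_one_le_mul₀ hδ] at this

theorem rpow_abs_det_mul_volume_affineOverlap_le {n : ℕ}
    {A : Matrix.GeneralLinearGroup (Fin n) ℝ} {W V : Matrix (Fin n) (Fin n) ℝ}
    (hW : W ∈ Matrix.unitaryGroup (Fin n) ℝ) (hV : V ∈ Matrix.unitaryGroup (Fin n) ℝ)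
    {s : Fin n → ℝ} (hs : ∀ i, 0 < s i)
    (hA : (A : Matrix (Fin n) (Fin n) ℝ) = W * Matrix.diagonal s * V) (a : Fin n → ℝ) {R δ : ℝ}
    (hR : 0 ≤ R) (hδ : 0 < δ) {i : Fin n} (hi : s i ≤ δ ^ 2 ∨ (δ ^ 2)⁻¹ ≤ s i) :
    |((A : Matrix (Fin n) (Fin n) ℝ).det)| ^ (-(1 / 2 : ℝ)) *
      (volume (affineOverlap A a R)).toReal ≤ (2 * (n * R)) ^ n * δ := by
  have hmin : ∀ j, 0 ≤ min 1 (s j) := fun j => le_min zero_le_one (hs j).le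
  have hdet : |(A : Matrix (Fin n) (Fin n) ℝ).det| = ∏ j, s j := by
    rw [hA, Matrix.det_mul, Matrix.det_mul, abs_mul, abs_mul,
      Matrix.abs_det_eq_one_of_mem_unitaryGroup hW, Matrix.abs_det_eq_one_of_mem_unitaryGroup hV,
      Matrix.det_diagonal, one_mul, mul_one, abs_of_pos (Finset.prod_pos fun j _ => hs j)]
  have hvol := ENNReal.toReal_le_of_le_ofReal
    (Finset.prod_nonneg fun j _ => mul_nonneg (by positivity) (hmin j))
    (volume_affineOverlap_le hW hV hs hA a hR)
  have hprod : ∏ j, s j ^ (-(1 / 2 : ℝ)) * min 1 (s j) ≤ δ := by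
    have h0 : ∀ j, 0 ≤ s j ^ (-(1 / 2 : ℝ)) * min 1 (s j) := fun j =>
      mul_nonneg (Real.rpow_nonneg (hs j).le _) (hmin j)
    rw [← Finset.mul_prod_erase _ _ (Finset.mem_univ i)]
    calc _ ≤ δ * 1 := mul_le_mul (rpow_neg_half_mul_min_le (hs i) hδ hi)
            (Finset.prod_le_one (fun j _ => h0 j) fun j _ => rpow_neg_half_mul_min_le_one (hs j))
            (Finset.prod_nonneg fun j _ => h0 j) hδ.le
      _ = δ := mul_one δ
  calc _ ≤ |((A : Matrix (Fin n) (Fin n) ℝ).det)| ^ (-(1 / 2 : ℝ)) *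
        ∏ j, 2 * (n * R) * min 1 (s j) := by gcongr
    _ = (2 * (n * R)) ^ n * ∏ j, s j ^ (-(1 / 2 : ℝ)) * min 1 (s j) := by
        rw [hdet, ← Real.finsetProd_rpow _ _ fun j _ => (hs j).le, Finset.prod_mul_distrib,
          Finset.prod_mul_distrib (f := fun j => s j ^ (-(1 / 2 : ℝ))), Finset.prod_const,
          Finset.card_univ, Fintype.card_fin]
        ring
    _ ≤ _ := by gcongr

theorem affineOverlap_eq_empty {n : ℕ} {A : Matrix.GeneralLinearGroup (Fin n) ℝ} {a : Fin n → ℝ}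
    {R c : ℝ} (hc : 0 ≤ c) (hA : ∀ i j, |((A⁻¹ : Matrix.GeneralLinearGroup (Fin n) ℝ) :
      Matrix (Fin n) (Fin n) ℝ) i j| ≤ c) (ha : n * c * R + R < ‖a‖) :
    affineOverlap A a R = ∅ := by
  refine Set.eq_empty_of_forall_notMem fun x hx => ha.not_ge ?_
  set y := ((A⁻¹ : Matrix.GeneralLinearGroup (Fin n) ℝ) : Matrix (Fin n) (Fin n) ℝ).mulVec x
  calc ‖a‖ = ‖y - (y - a)‖ := by rw [sub_sub_cancel]
    _ ≤ ‖y‖ + ‖y - a‖ := norm_sub_le _ _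
    _ ≤ n * c * ‖x‖ + R := add_le_add (Matrix.norm_mulVec_le_of_forall_abs_le hc hA x) hx.2
    _ ≤ n * c * R + R := by
        have := hx.1
        gcongr

/-- The overlap, normalised by the determinant, vanishes at infinity on `GL(n, ℝ) × ℝⁿ`. -/
theorem exists_isCompact_forall_notMem_affineOverlap_lt {n : ℕ} {R ε : ℝ} (hR : 0 ≤ R)
    (hε : 0 < ε) :
    ∃ K : Set (Matrix.GeneralLinearGroup (Fin n) ℝ × (Fin n → ℝ)), IsCompact K ∧
      ∀ (A : Matrix.GeneralLinearGroup (Fin n) ℝ) (a : Fin n → ℝ), (A, a) ∉ K →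
        |((A : Matrix (Fin n) (Fin n) ℝ).det)| ^ (-(1 / 2 : ℝ)) *
          (volume (affineOverlap A a R)).toReal < ε := by
  set δ : ℝ := ε / ((2 * (n * R)) ^ n + 1)
  have hδ : 0 < δ := by positivity
  set c : ℝ := n * (δ ^ 2)⁻¹
  have hc : 0 ≤ c := by positivity
  refine ⟨_, (isCompact_setOf_abs_entries_le n c).prod
    (isCompact_closedBall (0 : Fin n → ℝ) (n * c * R + R)), fun A a hK => ?_⟩
  obtain ⟨W, hW, V, hV, s, hs, hA⟩ := A.exists_unitary_diagonal_unitary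
  by_cases hi : ∃ i, s i ≤ δ ^ 2 ∨ (δ ^ 2)⁻¹ ≤ s i
  · obtain ⟨i, hi⟩ := hi
    refine (rpow_abs_det_mul_volume_affineOverlap_le hW hV hs hA a hR hδ hi).trans_lt ?_
    calc (2 * (n * R)) ^ n * δ < ((2 * (n * R)) ^ n + 1) * δ := by gcongr; linarith
      _ = ε := mul_div_cancel₀ _ (by positivity)
  · push Not at hi
    have hA1 : ∀ i j, |(A : Matrix (Fin n) (Fin n) ℝ) i j| ≤ c := fun i j => by
      rw [hA]
      exact Matrix.abs_mul_diagonal_mul_apply_le hW hV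
        (fun k => by rw [abs_of_pos (hs k)]; exact (hi k).2.le) i j
    have hA2 : ∀ i j, |((A⁻¹ : Matrix.GeneralLinearGroup (Fin n) ℝ) :
        Matrix (Fin n) (Fin n) ℝ) i j| ≤ c := fun i j => by
      rw [Matrix.GeneralLinearGroup.coe_inv_eq_of_eq_mul_diagonal_mul hW hV hs hA]
      refine Matrix.abs_mul_diagonal_mul_apply_le (Unitary.star_mem hV) (Unitary.star_mem hW)
        (fun k => ?_) i j
      rw [Pi.inv_apply, abs_of_pos (inv_pos.2 (hs k))]
      exact inv_anti₀ (by positivity) (hi k).1.le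
    have ha : n * c * R + R < ‖a‖ := by
      by_contra! h
      exact hK ⟨⟨hA1, hA2⟩, mem_closedBall_zero_iff.2 h⟩
    rw [affineOverlap_eq_empty hc hA2 ha]
    simpa using hε

theorem integral_affineAct_eq_add {n : ℕ} (A : Matrix.GeneralLinearGroup (Fin n) ℝ)
    (a : Fin n → ℝ) {ξ ξ' η η' : (Fin n → ℝ) → ℂ} (hξ : MemLp ξ 2 volume)
    (hξ' : MemLp ξ' 2 volume) (hη : MemLp η 2 volume) (hη' : MemLp η' 2 volume) :
    ∫ x, affineAct A a ξ x * (starRingEnd ℂ) (η x) =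
      (∫ x, affineAct A a (ξ - ξ') x * (starRingEnd ℂ) (η x)) +
      (∫ x, affineAct A a ξ' x * (starRingEnd ℂ) ((η - η') x)) +
      ∫ x, affineAct A a ξ' x * (starRingEnd ℂ) (η' x) := by
  have h1 := integrable_mul_conj (memLp_affineAct A a (hξ.sub hξ')) hη
  have h2 := integrable_mul_conj (memLp_affineAct A a hξ') (hη.sub hη')
  have h3 := integrable_mul_conj (memLp_affineAct A a hξ') hη'
  rw [← integral_add h1 h2, ← integral_add (by exact h1.add h2) h3]
  refine integral_congr_ae (.of_forall fun x => ?_)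
  simp only [affineAct, Pi.sub_apply, map_sub]
  ring

theorem norm_integral_affineAct_le_eLpNorm {n : ℕ} (A : Matrix.GeneralLinearGroup (Fin n) ℝ)
    (a : Fin n → ℝ) {ξ η : (Fin n → ℝ) → ℂ} (hξ : MemLp ξ 2 volume) (hη : MemLp η 2 volume) :
    ‖∫ x, affineAct A a ξ x * (starRingEnd ℂ) (η x)‖ ≤
      (eLpNorm ξ 2 volume).toReal * (eLpNorm η 2 volume).toReal := by
  rw [← eLpNorm_affineAct A a hξ]
  exact norm_integral_mul_conj_le (memLp_affineAct A a hξ) hη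

/-- All matrix coefficients of the natural unitary representation of
`GL(n,ℝ) ⋉ ℝⁿ` on `L²(ℝⁿ)`, `(π(A,a)ξ)(x) = |det A|^{-1/2} ξ(A⁻¹x - a)`, vanish at infinity:
for all square-integrable `ξ, η` and every `ε > 0` there is a compact set
`K ⊆ GL(n,ℝ) × ℝⁿ` outside of which `|⟨π(A,a)ξ, η⟩| < ε`. -/
theorem affine_representation_is_C0
    (n : ℕ) (hn : 1 ≤ n) (ξ η : (Fin n → ℝ) → ℂ)
    (hξ : MemLp ξ 2 (volume : Measure (Fin n → ℝ)))
    (hη : MemLp η 2 (volume : Measure (Fin n → ℝ))) :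
    ∀ ε : ℝ, 0 < ε →
      ∃ K : Set (Matrix.GeneralLinearGroup (Fin n) ℝ × (Fin n → ℝ)), IsCompact K ∧
        ∀ (A : Matrix.GeneralLinearGroup (Fin n) ℝ) (a : Fin n → ℝ), (A, a) ∉ K →
          ‖∫ x : Fin n → ℝ,
              ((|((A : Matrix (Fin n) (Fin n) ℝ).det)| ^ (-(1 / 2 : ℝ)) : ℝ) : ℂ) *
                ξ (((A⁻¹ : Matrix.GeneralLinearGroup (Fin n) ℝ) :
                    Matrix (Fin n) (Fin n) ℝ).mulVec x - a) *
                (starRingEnd ℂ) (η x) ∂(volume : Measure (Fin n → ℝ))‖ < ε := by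
  intro ε hε
  set L := (eLpNorm η 2 volume).toReal
  have hL : 0 ≤ L := ENNReal.toReal_nonneg
  obtain ⟨ξ', hξ', hξle, R₁, hR₁, hξb⟩ := exists_bounded_boundedSupport_eLpNorm_sub_le hξ
    (ε := ε / 3 / (L + 1)) (by positivity)
  set N := (eLpNorm ξ' 2 volume).toReal
  have hN : 0 ≤ N := ENNReal.toReal_nonneg
  obtain ⟨η', hη', hηle, R₂, hR₂, hηb⟩ := exists_bounded_boundedSupport_eLpNorm_sub_le hη
    (ε := ε / 3 / (N + 1)) (by positivity)
  set R := max R₁ R₂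
  have hR : 0 ≤ R := hR₁.trans (le_max_left _ _)
  obtain ⟨K, hK, hKlt⟩ := exists_isCompact_forall_notMem_affineOverlap_lt (n := n) hR
    (ε := ε / 3 / (R ^ 2 + 1)) (by positivity)
  refine ⟨K, hK, fun A a hAa => ?_⟩
  change ‖∫ x, affineAct A a ξ x * (starRingEnd ℂ) (η x)‖ < ε
  have h1 : ‖∫ x, affineAct A a (ξ - ξ') x * (starRingEnd ℂ) (η x)‖ ≤ ε / 3 :=
    calc _ ≤ _ := norm_integral_affineAct_le_eLpNorm A a (hξ.sub hξ') hη
      _ ≤ ε / 3 / (L + 1) * (L + 1) := by gcongr; linarith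
      _ = ε / 3 := by field_simp
  have h2 : ‖∫ x, affineAct A a ξ' x * (starRingEnd ℂ) ((η - η') x)‖ ≤ ε / 3 :=
    calc _ ≤ _ := norm_integral_affineAct_le_eLpNorm A a hξ' (hη.sub hη')
      _ ≤ (N + 1) * (ε / 3 / (N + 1)) := by gcongr; linarith
      _ = ε / 3 := by field_simp
  have h3 : ‖∫ x, affineAct A a ξ' x * (starRingEnd ℂ) (η' x)‖ < ε / 3 := by
    have hle := norm_integral_affineAct_le A a (M := R) (R := R)
      (fun x => ⟨(hξb x).1.trans (le_max_left _ _),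
        fun hx => (hξb x).2 ((le_max_left _ _).trans_lt hx)⟩)
      (fun x => ⟨(hηb x).1.trans (le_max_right _ _),
        fun hx => (hηb x).2 ((le_max_right _ _).trans_lt hx)⟩)
    have hlt := hKlt A a hAa
    rw [lt_div_iff₀ (by positivity)] at hlt
    set v := |((A : Matrix (Fin n) (Fin n) ℝ).det)| ^ (-(1 / 2 : ℝ)) *
      (volume (affineOverlap A a R)).toReal with hv
    have hv0 : 0 ≤ v := by positivity
    calc _ ≤ _ := hle
      _ = v * R ^ 2 := by rw [hv]; ring
      _ ≤ v * (R ^ 2 + 1) := by gcongr; linarith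
      _ < ε / 3 := hlt
  rw [integral_affineAct_eq_add A a hξ hξ' hη hη']
  calc _ ≤ _ := norm_add₃_le
    _ < ε / 3 + ε / 3 + ε / 3 := add_lt_add_of_le_of_lt (add_le_add h1 h2) h3
    _ = ε := by ring
end
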